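/- Let n ≥ 1000. Then R_{n,2}(x) has no factor of degree d in ℤ[x] for any d with 3 ≤ d ≤ 9. Moreover, if n + 1 is not a power of 2, then R_{n,2}(x) also has no factor of degree 1 or 2 in ℤ[x]. -/

import Mathlib

open Polynomial Finset

/-- Probabilists' Hermite polynomials over `ℤ`:
`He 0 = 1`, `He 1 = X`, `He (n+1) = X * He n - n * He (n-1)`. -/
noncomputable def He : ℕ → Polynomial ℤ
  | 0 => 1
  | 1 => Polynomial.X
  | n + 2 => Polynomial.X * He (n + 1) - Polynomial.C ((n : ℤ) + 1) * He n

/-- The Wronskian `Wr[He_{n_1}, …, He_{n_r}]` of the Hermite polynomials indexed by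
a degree sequence `ns : Fin r → ℕ`; entry `(i,j)` is the `i`-th derivative of `He (ns j)`. -/
noncomputable def wronskHe {r : ℕ} (ns : Fin r → ℕ) : Polynomial ℤ :=
  Matrix.det (Matrix.of fun i j : Fin r =>
    (fun q : Polynomial ℤ => Polynomial.derivative q)^[(i : ℕ)] (He (ns j)))

/-- `Δ(n_λ) = ∏_{i<j} (n_j - n_i)`. -/
def vand {r : ℕ} (ns : Fin r → ℕ) : ℤ :=
  ∏ j : Fin r, ∏ i ∈ Finset.Iio j, ((ns j : ℤ) - (ns i : ℤ))

/-- The degree sequence `n_λ` of a partition `λ = (λ_1 ≥ … ≥ λ_r)`,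
`n_i = λ_{r+1-i} + (i-1)` (indices shifted to start at `0`). -/
def degSeq {r : ℕ} (lam : Fin r → ℕ) : Fin r → ℕ :=
  fun i => lam i.rev + (i : ℕ)

/-- `d_λ` = (number of odd entries of the degree sequence) − (number of even entries). -/
def dStat {r : ℕ} (ns : Fin r → ℕ) : ℤ :=
  ((Finset.univ.filter fun i => Odd (ns i)).card : ℤ) -
    ((Finset.univ.filter fun i => Even (ns i)).card : ℤ)

/-- `s_λ = d_λ(d_λ+1)/2`, the size of the 2-core of `λ`. -/
def sStat {r : ℕ} (ns : Fin r → ℕ) : ℕ :=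
  (dStat ns * (dStat ns + 1) / 2).toNat

theorem Nat.pow_mod_of_period {r L A P x y : ℕ} (hL : 0 < L) (hAP : 1 < A * P)
    (h : r ^ L % (A * P) = 1)
    (hd : ∀ s < L, r ^ s % A = x → r ^ s % P = y) (a : ℕ) (ha : r ^ a % A = x) :
    r ^ a % P = y := by
  have key : r ^ a % (A * P) = r ^ (a % L) % (A * P) := by
    conv_lhs => rw [← Nat.div_add_mod a L, pow_add, pow_mul, Nat.mul_mod, Nat.pow_mod, h]
    rw [one_pow, Nat.mod_eq_of_lt hAP, one_mul, Nat.mod_mod]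
  have hA : r ^ a % A = r ^ (a % L) % A := by
    rw [← Nat.mod_mul_right_mod (r ^ a) A P, key, Nat.mod_mul_right_mod]
  have hP : r ^ a % P = r ^ (a % L) % P := by
    rw [← Nat.mod_mul_left_mod (r ^ a) A P, key, Nat.mod_mul_left_mod]
  rw [hP]
  exact hd _ (Nat.mod_lt _ hL) (hA ▸ ha)

theorem Nat.dvd_of_dvd_succ_pow {r L A P n a : ℕ} (hL : 0 < L) (hA : 1 < A) (hP : 1 < P)
    (h : r ^ L % (A * P) = 1) (hd : ∀ s < L, r ^ s % A = A - 1 → r ^ s % P = P - 1)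
    (hn : n = r ^ a) (hdvd : A ∣ n + 1) : P ∣ n + 1 := by
  have e : ∀ {B : ℕ}, 1 < B → (B ∣ n + 1 ↔ n % B = B - 1) := by
    intro B hB
    have h1 := Nat.mod_lt n (show 0 < B by lia)
    rw [Nat.dvd_iff_mod_eq_zero, Nat.add_mod, Nat.mod_eq_of_lt hB]
    rcases eq_or_lt_of_le (show n % B + 1 ≤ B by lia) with h2 | h2
    · rw [h2, Nat.mod_self]; lia
    · rw [Nat.mod_eq_of_lt h2]; lia
  rw [e hP, hn]
  exact Nat.pow_mod_of_period hL (Nat.one_lt_mul_iff.2 (by lia)) h hd a (hn ▸ (e hA).1 hdvd)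

theorem Nat.dvd_of_dvd_pow_pred {r L A P n a : ℕ} (hL : 0 < L) (hA : 1 < A) (hP : 1 < P)
    (h : r ^ L % (A * P) = 1) (hd : ∀ s < L, r ^ s % A = 1 → r ^ s % P = 1)
    (hn : n + 1 = r ^ a) (hdvd : A ∣ n) : P ∣ n := by
  have h1 : r ^ a % A = 1 := by
    obtain ⟨k, rfl⟩ := hdvd
    rw [← hn, Nat.mul_add_mod, Nat.mod_eq_of_lt hA]
  have h2 := Nat.pow_mod_of_period hL (Nat.one_lt_mul_iff.2 (by lia)) h hd a h1
  rw [← hn] at h2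
  have h3 := (Nat.modEq_iff_dvd' (show 1 ≤ n + 1 by lia)).1
    (show 1 ≡ n + 1 [MOD P] by rw [Nat.ModEq, h2, Nat.mod_eq_of_lt hP])
  simpa using h3

theorem Nat.pow_mul_pow_le_of_not_dvd {q r b c B C : ℕ} (hq : 0 < q) (hr : 0 < r)
    (h1 : ¬ q ^ (B + 1) ∣ q ^ b * r ^ c) (h2 : ¬ r ^ (C + 1) ∣ q ^ b * r ^ c) :
    q ^ b * r ^ c ≤ q ^ B * r ^ C := by
  have hb : b ≤ B := by
    by_contra! h
    exact h1 (Dvd.dvd.mul_right (pow_dvd_pow q h) _)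
  have hc : c ≤ C := by
    by_contra! h
    exact h2 (Dvd.dvd.mul_left (pow_dvd_pow r h) _)
  exact Nat.mul_le_mul (Nat.pow_le_pow_right hq hb) (Nat.pow_le_pow_right hr hc)

theorem Nat.exists_eq_of_prime_dvd_lt_seven {m : ℕ} (hm : m ≠ 0)
    (h : ∀ p, p.Prime → p ∣ m → p < 7) : ∃ a b c, m = 2 ^ a * 3 ^ b * 5 ^ c := by
  induction m using Nat.strong_induction_on with
  | _ m ih =>
    rcases eq_or_ne m 1 with rfl | h1
    · exact ⟨0, 0, 0, rfl⟩
    · have hp := Nat.minFac_prime h1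
      have hd := Nat.minFac_dvd m
      have hlt := h _ hp hd
      generalize m.minFac = q at hp hd hlt
      obtain ⟨k, rfl⟩ := hd
      have hk : k ≠ 0 := by rintro rfl; simp at hm
      obtain ⟨a, b, c, habc⟩ := ih k (by have := hp.two_le; nlinarith [Nat.pos_of_ne_zero hk]) hk
        (fun p pp pd => h p pp (pd.mul_left q))
      interval_cases q
      · exact absurd hp (by norm_num)
      · exact absurd hp (by norm_num)
      · exact ⟨a + 1, b, c, by rw [habc]; ring⟩
      · exact ⟨a, b + 1, c, by rw [habc]; ring⟩
      · exact absurd hp (by norm_num)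
      · exact ⟨a, b, c + 1, by rw [habc]; ring⟩
      · exact absurd hp (by norm_num)

/-- Størmer's theorem for the primes `2, 3, 5`. -/
theorem Nat.exists_prime_seven_le_dvd_mul_succ {n : ℕ} (hn : 81 ≤ n) :
    ∃ p, p.Prime ∧ 7 ≤ p ∧ (p ∣ n ∨ p ∣ n + 1) := by
  by_contra! H
  obtain ⟨a, b, c, h1⟩ := Nat.exists_eq_of_prime_dvd_lt_seven (m := n) (by lia)
    (fun p pp pd => by by_contra! h; exact (H p pp h).1 pd)
  obtain ⟨a', b', c', h2⟩ := Nat.exists_eq_of_prime_dvd_lt_seven (m := n + 1) (by lia)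
    (fun p pp pd => by by_contra! h; exact (H p pp h).2 pd)
  have cop : ∀ q, q ≠ 1 → ∀ x y : ℕ, q ^ x ∣ n → q ^ y ∣ n + 1 → x = 0 ∨ y = 0 := by
    intro q hq x y hx hy
    by_contra! h
    have d1 : q ∣ n := (dvd_pow_self q h.1).trans hx
    have d2 : q ∣ n + 1 := (dvd_pow_self q h.2).trans hy
    exact hq (Nat.dvd_one.1 ((Nat.dvd_add_right d1).1 d2))
  have ca := cop 2 (by norm_num) a a' (h1 ▸ ⟨3 ^ b * 5 ^ c, by ring⟩)
    (h2 ▸ ⟨3 ^ b' * 5 ^ c', by ring⟩)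
  have cb := cop 3 (by norm_num) b b' (h1 ▸ ⟨2 ^ a * 5 ^ c, by ring⟩)
    (h2 ▸ ⟨2 ^ a' * 5 ^ c', by ring⟩)
  have cc := cop 5 (by norm_num) c c' (h1 ▸ ⟨2 ^ a * 3 ^ b, by ring⟩)
    (h2 ▸ ⟨2 ^ a' * 3 ^ b', by ring⟩)
  rcases ca with rfl | rfl <;> rcases cb with rfl | rfl <;> rcases cc with rfl | rfl <;>
    simp only [pow_zero, mul_one, one_mul] at h1 h2
  · lia
  · have := Nat.pow_mul_pow_le_of_not_dvd (q := 2) (r := 3) (b := a') (c := b') (B := 1) (C := 1)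
      (by norm_num) (by norm_num)
      (fun hd => (H 7 (by norm_num) (by norm_num)).2 (Nat.dvd_of_dvd_succ_pow (L := 6) (A := 4)
        (by norm_num) (by norm_num) (by norm_num) (by norm_num) (by decide) h1 (h2 ▸ hd)))
      (fun hd => (H 7 (by norm_num) (by norm_num)).2 (Nat.dvd_of_dvd_succ_pow (L := 6) (A := 9)
        (by norm_num) (by norm_num) (by norm_num) (by norm_num) (by decide) h1 (h2 ▸ hd)))
    lia
  · have := Nat.pow_mul_pow_le_of_not_dvd (q := 2) (r := 5) (b := a') (c := c') (B := 2) (C := 1)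
      (by norm_num) (by norm_num)
      (fun hd => (H 7 (by norm_num) (by norm_num)).2 (Nat.dvd_of_dvd_succ_pow (L := 6) (A := 8)
        (by norm_num) (by norm_num) (by norm_num) (by norm_num) (by decide) h1 (h2 ▸ hd)))
      (fun hd => (H 1181 (by norm_num) (by norm_num)).2 (Nat.dvd_of_dvd_succ_pow (L := 20) (A := 25)
        (by norm_num) (by norm_num) (by norm_num) (by norm_num) (by decide) h1 (h2 ▸ hd)))
    lia
  · have := Nat.pow_mul_pow_le_of_not_dvd (q := 3) (r := 5) (b := b) (c := c) (B := 1) (C := 1)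
      (by norm_num) (by norm_num)
      (fun hd => (H 7 (by norm_num) (by norm_num)).1 (Nat.dvd_of_dvd_pow_pred (L := 6) (A := 9)
        (by norm_num) (by norm_num) (by norm_num) (by norm_num) (by decide) h2 (h1 ▸ hd)))
      (fun hd => (H 11 (by norm_num) (by norm_num)).1 (Nat.dvd_of_dvd_pow_pred (L := 20) (A := 25)
        (by norm_num) (by norm_num) (by norm_num) (by norm_num) (by decide) h2 (h1 ▸ hd)))
    lia
  · have := Nat.pow_mul_pow_le_of_not_dvd (q := 3) (r := 5) (b := b') (c := c') (B := 2) (C := 1)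
      (by norm_num) (by norm_num)
      (fun hd => (H 19 (by norm_num) (by norm_num)).2 (Nat.dvd_of_dvd_succ_pow (L := 18) (A := 27)
        (by norm_num) (by norm_num) (by norm_num) (by norm_num) (by decide) h1 (h2 ▸ hd)))
      (fun hd => (H 41 (by norm_num) (by norm_num)).2 (Nat.dvd_of_dvd_succ_pow (L := 20) (A := 25)
        (by norm_num) (by norm_num) (by norm_num) (by norm_num) (by decide) h1 (h2 ▸ hd)))
    lia
  · have := Nat.pow_mul_pow_le_of_not_dvd (q := 2) (r := 5) (b := a) (c := c) (B := 4) (C := 1)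
      (by norm_num) (by norm_num)
      (fun hd => (H 41 (by norm_num) (by norm_num)).1 (Nat.dvd_of_dvd_pow_pred (L := 8) (A := 32)
        (by norm_num) (by norm_num) (by norm_num) (by norm_num) (by decide) h2 (h1 ▸ hd)))
      (fun hd => (H 11 (by norm_num) (by norm_num)).1 (Nat.dvd_of_dvd_pow_pred (L := 20) (A := 25)
        (by norm_num) (by norm_num) (by norm_num) (by norm_num) (by decide) h2 (h1 ▸ hd)))
    lia
  · have := Nat.pow_mul_pow_le_of_not_dvd (q := 2) (r := 3) (b := a) (c := b) (B := 4) (C := 1)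
      (by norm_num) (by norm_num)
      (fun hd => (H 13 (by norm_num) (by norm_num)).1 (Nat.dvd_of_dvd_pow_pred (L := 8) (A := 32)
        (by norm_num) (by norm_num) (by norm_num) (by norm_num) (by decide) h2 (h1 ▸ hd)))
      (fun hd => (H 7 (by norm_num) (by norm_num)).1 (Nat.dvd_of_dvd_pow_pred (L := 6) (A := 9)
        (by norm_num) (by norm_num) (by norm_num) (by norm_num) (by decide) h2 (h1 ▸ hd)))
    lia
  · lia

/-- Two integers greater than `320` without prime factors other than `2` and `3` differ
by more than `4`. -/
theorem Nat.four_lt_sub_of_three_smooth {u d : ℕ} (hu : 321 ≤ u) (hd : 1 ≤ d)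
    (h1 : ∀ p, p.Prime → p ∣ u → p ≤ 3) (h2 : ∀ p, p.Prime → p ∣ u + d → p ≤ 3) : 4 < d := by
  have one : ∀ v, 81 ≤ v → (∀ p, p.Prime → p ∣ v → p ≤ 3) →
      (∀ p, p.Prime → p ∣ v + 1 → p ≤ 3) → False := by
    intro v hv k1 k2
    obtain ⟨p, pp, p7, pd | pd⟩ := Nat.exists_prime_seven_le_dvd_mul_succ hv
    · have := k1 p pp pd; lia
    · have := k2 p pp pd; lia
  have small : ∀ v, 2 ≤ v → (∀ p, p.Prime → p ∣ v → p ≤ 3) → v % 2 = 0 ∨ v % 3 = 0 := by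
    intro v hv k
    have hp := Nat.minFac_prime (n := v) (by lia)
    have hdv := Nat.minFac_dvd v
    have := k _ hp hdv
    have := hp.two_le
    generalize v.minFac = q at *
    interval_cases q
    · left; lia
    · right; lia
  have two : ∀ v, 160 ≤ v → (∀ p, p.Prime → p ∣ v → p ≤ 3) →
      (∀ p, p.Prime → p ∣ v + 2 → p ≤ 3) → False := by
    intro v hv k1 k2
    have e1 := small v (by lia) k1
    have e2 := small (v + 2) (by lia) k2
    obtain ⟨w, rfl⟩ : 2 ∣ v := by lia
    rcases eq_or_lt_of_le (show 80 ≤ w by lia) with rfl | hw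
    · have := k1 5 (by norm_num) (by norm_num)
      lia
    exact one w (by lia) (fun p pp pd => k1 p pp (pd.mul_left 2))
      (fun p pp pd => k2 p pp (by rw [show 2 * w + 2 = 2 * (w + 1) by ring]; exact pd.mul_left 2))
  by_contra! h
  have e1 := small u (by lia) h1
  have e2 := small (u + d) (by lia) h2
  interval_cases d
  · exact one u (by lia) h1 h2
  · exact two u (by lia) h1 h2
  · obtain ⟨w, rfl⟩ : 3 ∣ u := by lia
    exact one w (by lia) (fun p pp pd => h1 p pp (pd.mul_left 3))
      (fun p pp pd => h2 p pp (by rw [show 3 * w + 3 = 3 * (w + 1) by ring]; exact pd.mul_left 3))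
  · obtain ⟨w, rfl⟩ : 2 ∣ u := by lia
    exact two w (by lia) (fun p pp pd => h1 p pp (pd.mul_left 2))
      (fun p pp pd => h2 p pp (by rw [show 2 * w + 4 = 2 * (w + 2) by ring]; exact pd.mul_left 2))

theorem Nat.exists_prime_eleven_le_dvd {n : ℕ} (hn : 1000 ≤ n) :
    ∃ p, p.Prime ∧ 11 ≤ p ∧ (p ∣ n + 1 ∨ p ∣ n ∨ p ∣ n - 2 ∨ p ∣ n - 3) := by
  by_contra! H
  obtain ⟨m, rfl⟩ : ∃ m, n = m + 3 := ⟨n - 3, by lia⟩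
  have good : ∀ x, (∀ p, p.Prime → 11 ≤ p → ¬ p ∣ x) → x % 5 ≠ 0 → x % 7 ≠ 0 →
      ∀ p, p.Prime → p ∣ x → p ≤ 3 := by
    intro x hx h5 h7 p pp pd
    by_contra! h
    have : p < 11 := by by_contra! h'; exact hx p pp h' pd
    interval_cases p
    · exact absurd pp (by norm_num)
    · lia
    · exact absurd pp (by norm_num)
    · lia
    all_goals exact absurd pp (by norm_num)
  have g0 := good m (fun p pp hp hd => (H p pp hp).2.2.2 (by simpa using hd))
  have g1 := good (m + 1) (fun p pp hp hd => (H p pp hp).2.2.1 (by simpa using hd))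
  have g3 := good (m + 3) (fun p pp hp hd => (H p pp hp).2.1 hd)
  have g4 := good (m + 4) (fun p pp hp hd => (H p pp hp).1 hd)
  have pair : ∀ u d, 997 ≤ u → 1 ≤ d → d ≤ 4 → (∀ p, p.Prime → p ∣ u → p ≤ 3) →
      (∀ p, p.Prime → p ∣ u + d → p ≤ 3) → False := fun u d hu hd hd4 k1 k2 => by
    have := Nat.four_lt_sub_of_three_smooth (by lia) hd k1 k2
    lia
  have p1 := pair m 1 (by lia) (by lia) (by lia)
  have p2 := pair m 3 (by lia) (by lia) (by lia)
  have p3 := pair m 4 (by lia) (by lia) (by lia)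
  have p4 := pair (m + 1) 2 (by lia) (by lia) (by lia)
  have p5 := pair (m + 1) 3 (by lia) (by lia) (by lia)
  have p6 := pair (m + 3) 1 (by lia) (by lia) (by lia)
  rcases (show (m % 5 ≠ 0 ∧ m % 7 ≠ 0 ∧ (m + 1) % 5 ≠ 0 ∧ (m + 1) % 7 ≠ 0) ∨
    (m % 5 ≠ 0 ∧ m % 7 ≠ 0 ∧ (m + 3) % 5 ≠ 0 ∧ (m + 3) % 7 ≠ 0) ∨
    (m % 5 ≠ 0 ∧ m % 7 ≠ 0 ∧ (m + 4) % 5 ≠ 0 ∧ (m + 4) % 7 ≠ 0) ∨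
    ((m + 1) % 5 ≠ 0 ∧ (m + 1) % 7 ≠ 0 ∧ (m + 3) % 5 ≠ 0 ∧ (m + 3) % 7 ≠ 0) ∨
    ((m + 1) % 5 ≠ 0 ∧ (m + 1) % 7 ≠ 0 ∧ (m + 4) % 5 ≠ 0 ∧ (m + 4) % 7 ≠ 0) ∨
    ((m + 3) % 5 ≠ 0 ∧ (m + 3) % 7 ≠ 0 ∧ (m + 4) % 5 ≠ 0 ∧ (m + 4) % 7 ≠ 0) by
      clear p1 p2 p3 p4 p5 p6 g0 g1 g3 g4 good pair H hn
      lia) with h | h | h | h | h | h <;> obtain ⟨a, b, c, d⟩ := h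
  · exact p1 (g0 a b) (g1 c d)
  · exact p2 (g0 a b) (g3 c d)
  · exact p3 (g0 a b) (g4 c d)
  · exact p4 (g1 a b) (g3 c d)
  · exact p5 (g1 a b) (g4 c d)
  · exact p6 (g3 a b) (g4 c d)

/-- The `p`-adic absolute value on `ℤ`. -/
noncomputable def intPadicAbs (p : ℕ) [Fact p.Prime] : AbsoluteValue ℤ ℝ :=
  (Rat.AbsoluteValue.padic p).comp (f := Int.castRingHom ℚ) Int.cast_injective

theorem intPadicAbs_apply (p : ℕ) [Fact p.Prime] (a : ℤ) :
    intPadicAbs p a = (padicNorm p (a : ℚ) : ℝ) := rfl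

theorem isNonarchimedean_intPadicAbs (p : ℕ) [Fact p.Prime] :
    IsNonarchimedean (intPadicAbs p) := by
  intro a b
  simp only [intPadicAbs_apply, Int.cast_add]
  exact mod_cast (padicNorm.nonarchimedean (p := p) (q := a) (r := b))

theorem intPadicAbs_le_one (p : ℕ) [Fact p.Prime] (a : ℤ) : intPadicAbs p a ≤ 1 := by
  rw [intPadicAbs_apply]
  exact_mod_cast padicNorm.of_int a

theorem intPadicAbs_self (p : ℕ) [Fact p.Prime] : intPadicAbs p p = (p : ℝ)⁻¹ := by
  rw [intPadicAbs_apply, Int.cast_natCast, padicNorm.padicNorm_p_of_prime]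
  simp

theorem intPadicAbs_le_of_dvd (p : ℕ) [Fact p.Prime] {a b : ℤ} (h : a ∣ b) :
    intPadicAbs p b ≤ intPadicAbs p a := by
  obtain ⟨k, rfl⟩ := h
  rw [map_mul]
  exact mul_le_of_le_one_right (AbsoluteValue.nonneg _ _) (intPadicAbs_le_one p k)

theorem intPadicAbs_natCast (p : ℕ) [Fact p.Prime] {m : ℕ} (hm : m ≠ 0) :
    intPadicAbs p m = (p : ℝ)⁻¹ ^ padicValNat p m := by
  rw [intPadicAbs_apply, Int.cast_natCast, padicNorm.eq_zpow_of_nonzero (by exact_mod_cast hm),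
    padicValRat.of_nat]
  simp

/-- If all coefficients of a polynomial with unit leading coefficient are divisible by `p`, except
for the top `ℓ + 1`, and its Newton polygon has slope at most `-log c / log p`, then every factor
of degree `e > ℓ` satisfies `c ^ e ≤ 1 / p`. -/
theorem pow_natDegree_le_inv_prime_of_dvd (p : ℕ) [Fact p.Prime] {R g : ℤ[X]} {ℓ : ℕ} {c : ℝ}
    (hc : 0 < c) (hlead : IsUnit R.leadingCoeff) (h0 : R.coeff 0 ≠ 0)
    (hp : ∀ j, j + ℓ < R.natDegree → (p : ℤ) ∣ R.coeff j)
    (hslope : ∀ j, intPadicAbs p (R.coeff j) * c ^ j ≤ intPadicAbs p (R.coeff 0))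
    (hg : g ∣ R) (hdeg : ℓ < g.natDegree) : c ^ g.natDegree ≤ (p : ℝ)⁻¹ := by
  have hpp : Prime (p : ℤ) := Nat.prime_iff_prime_int.1 Fact.out
  obtain ⟨h, rfl⟩ := hg
  set v := intPadicAbs p
  rw [leadingCoeff_mul, IsUnit.mul_iff] at hlead
  have hg0 : g ≠ 0 := by rintro rfl; simp at h0
  have hh0 : h ≠ 0 := by rintro rfl; simp at h0
  have hpg : (p : ℤ) ∣ g.coeff 0 := by
    by_contra hng
    have hex : ∃ j, ¬ (p : ℤ) ∣ h.coeff j :=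
      ⟨h.natDegree, fun hd => hpp.not_isUnit (isUnit_of_dvd_unit hd hlead.2)⟩
    classical
    have hmin := Nat.find_spec hex
    have hle : Nat.find hex ≤ h.natDegree :=
      Nat.find_min' hex fun hd => hpp.not_isUnit (isUnit_of_dvd_unit hd hlead.2)
    have hlt : ∀ i, i < Nat.find hex → (p : ℤ) ∣ h.coeff i := fun i hi =>
      not_not.1 (Nat.find_min hex hi)
    generalize Nat.find hex = j₀ at hmin hle hlt
    have hdvd := hp j₀ (by rw [natDegree_mul hg0 hh0]; omega)
    rw [coeff_mul, ← Finset.add_sum_erase _ _ (a := (0, j₀))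
      (Finset.HasAntidiagonal.mem_antidiagonal.2 (zero_add j₀))] at hdvd
    refine (hpp.dvd_or_dvd ((Int.dvd_add_left ?_).1 hdvd)).elim hng hmin
    refine Finset.dvd_sum fun x hx => ?_
    simp only [Finset.mem_erase, Finset.HasAntidiagonal.mem_antidiagonal, ne_eq, Prod.ext_iff] at hx
    exact (hlt _ (by omega)).mul_left _
  have hR : (g * h).gaussNorm v c ≤ v (g.coeff 0) * v (h.coeff 0) := by
    obtain ⟨i, hi⟩ := exists_eq_gaussNorm v c (g * h)
    rw [hi, ← map_mul, ← mul_coeff_zero]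
    exact hslope i
  rw [gaussNorm_mul (isNonarchimedean_intPadicAbs p) hc] at hR
  have e1 := le_gaussNorm v g hc.le 0
  have e2 := le_gaussNorm v h hc.le 0
  have e3 := le_gaussNorm v g hc.le g.natDegree
  have e4 : v g.leadingCoeff = 1 := by
    rcases Int.isUnit_iff.1 hlead.1 with h | h <;> simp [h]
  have hv : 0 < v (h.coeff 0) := AbsoluteValue.pos _ (by
    intro hz; rw [mul_coeff_zero, hz, mul_zero] at h0; exact h0 rfl)
  have e5 : v (g.coeff 0) ≤ (p : ℝ)⁻¹ := intPadicAbs_self p ▸ intPadicAbs_le_of_dvd p hpg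
  rw [coeff_natDegree, e4, one_mul] at e3
  rw [pow_zero, mul_one] at e1 e2
  have e6 : g.gaussNorm v c ≤ v (g.coeff 0) := by
    by_contra! hcon
    nlinarith [AbsoluteValue.nonneg v (g.coeff 0)]
  linarith

theorem Polynomial.derivative_hermite_succ (n : ℕ) :
    derivative (hermite (n + 1)) = ((n : ℤ[X]) + 1) * hermite n := by
  induction n with
  | zero => simp
  | succ n ih =>
    rw [hermite_succ (n + 1), derivative_sub, derivative_mul, derivative_X, ih, derivative_mul,
      hermite_succ n]
    simp only [derivative_add, derivative_natCast, derivative_one]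
    push_cast
    ring

theorem Polynomial.hermite_add_two (n : ℕ) :
    hermite (n + 2) = X * hermite (n + 1) - ((n : ℤ[X]) + 1) * hermite n := by
  rw [hermite_succ (n + 1), derivative_hermite_succ]

theorem He_eq_hermite : ∀ n, He n = hermite n
  | 0 => by simp [He]
  | 1 => by simp [He]
  | n + 2 => by
    rw [He, He_eq_hermite (n + 1), He_eq_hermite n, hermite_add_two]
    simp

/-- The Hermite differential equation, read off on coefficients. -/
theorem Polynomial.coeff_hermite_mul_eq_coeff_hermite_add_two (n i : ℕ) :
    ((n : ℤ) + 2) * (n + 1) * (hermite n).coeff i =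
      ((i : ℤ) - (n + 2)) * (hermite (n + 2)).coeff i := by
  have h1 := derivative_hermite_succ (n + 1)
  have h2 : ((n : ℤ[X]) + 2) * (((n : ℤ[X]) + 1) * hermite n) =
      X * derivative (hermite (n + 2)) - ((n : ℤ[X]) + 2) * hermite (n + 2) := by
    rw [h1, hermite_add_two]
    push_cast
    ring
  have h3 := congrArg (fun q => coeff q i) h2
  have h4 : coeff (X * derivative (hermite (n + 2))) i = i * (hermite (n + 2)).coeff i := by
    cases i with
    | zero => simp
    | succ i => rw [coeff_X_mul, coeff_derivative]; push_cast; ring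
  have e1 : ((n : ℤ[X]) + 2) = C ((n : ℤ) + 2) := by simp
  have e2 : ((n : ℤ[X]) + 1) = C ((n : ℤ) + 1) := by simp
  simp only [e1, e2, coeff_sub, coeff_C_mul, h4] at h3
  linear_combination h3

theorem degSeq_two (n m : ℕ) : degSeq ![n, m] = ![m, n + 1] := by
  funext i
  fin_cases i <;> simp [degSeq, Fin.rev]

theorem vand_two (a b : ℕ) : vand ![a, b] = (b : ℤ) - a := by
  have h : Finset.Iio (1 : Fin 2) = {0} := by decide
  have h0 : Finset.Iio (0 : Fin 2) = ∅ := by decide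
  simp [vand, Fin.prod_univ_two, h, h0]

theorem wronskHe_two (a b : ℕ) :
    wronskHe ![a, b] = He a * derivative (He b) - He b * derivative (He a) := by
  simp [wronskHe, Matrix.det_fin_two]

theorem sStat_two_succ (n : ℕ) : sStat ![2, n + 1] = n % 2 := by
  rcases Nat.mod_two_eq_zero_or_one n with h | h
  · have h1 : (Finset.univ.filter fun i : Fin 2 => Odd (![2, n + 1] i)) = {1} := by
      ext i; fin_cases i <;> simp [Nat.odd_iff]; omega
    have h2 : (Finset.univ.filter fun i : Fin 2 => Even (![2, n + 1] i)) = {0} := by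
      ext i; fin_cases i <;> simp [Nat.even_iff]; omega
    simp [sStat, dStat, h1, h2, h]
  · have h1 : (Finset.univ.filter fun i : Fin 2 => Odd (![2, n + 1] i)) = ∅ := by
      ext i; fin_cases i <;> simp [Nat.odd_iff]; omega
    have h2 : (Finset.univ.filter fun i : Fin 2 => Even (![2, n + 1] i)) = Finset.univ := by
      ext i; fin_cases i <;> simp [Nat.even_iff]; omega
    rw [sStat, dStat, h1, h2, h]
    simp

theorem wronskHe_two_succ (n : ℕ) :
    wronskHe ![2, n + 3] = ((n : ℤ[X]) + 1) * (hermite (n + 4) + 2 * (n + 3) * hermite (n + 2)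
      + (n + 3) * (n + 2) * hermite n) := by
  have h2 : hermite 2 = X ^ 2 - 1 := by rw [hermite_add_two 0]; simp; ring
  rw [wronskHe_two, He_eq_hermite, He_eq_hermite, derivative_hermite_succ, h2,
    hermite_add_two (n + 2), hermite_add_two (n + 1), hermite_add_two n]
  simp
  ring

/-- The coefficients of the Wronskian Hermite polynomial of the partition `(n, 2)`. -/
theorem coeff_wronskianHermite_two {n : ℕ} (hn : 2 ≤ n) {HeL : ℤ[X]}
    (hHe : C (vand (degSeq ![n, 2])) * HeL = wronskHe (degSeq ![n, 2])) (i : ℕ) :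
    ((n : ℤ) + 2) * (n - 1) * HeL.coeff i =
      (((i : ℤ) - 2) ^ 2 + (n - 2)) * (hermite (n + 2)).coeff i := by
  obtain ⟨m, rfl⟩ : ∃ m, n = m + 2 := ⟨n - 2, by omega⟩
  rw [degSeq_two, vand_two, wronskHe_two_succ] at hHe
  have h0 : ((m : ℤ) + 1) ≠ 0 := by positivity
  have e1 : C ((((m + 2 + 1 : ℕ) : ℤ)) - (2 : ℕ)) = (m : ℤ[X]) + 1 := by
    push_cast; simp; ring
  have e2 : ((m : ℤ[X]) + 1) ≠ 0 := by exact_mod_cast Nat.succ_ne_zero m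
  rw [e1] at hHe
  have h1 := congrArg (fun q => coeff q i) (mul_left_cancel₀ e2 hHe)
  have e3 : 2 * ((m : ℤ[X]) + 3) = C (2 * ((m : ℤ) + 3)) := by simp
  have e4 : ((m : ℤ[X]) + 3) * (m + 2) = C (((m : ℤ) + 3) * (m + 2)) := by simp
  simp only [e3, e4, coeff_add, coeff_C_mul] at h1
  have h2 := coeff_hermite_mul_eq_coeff_hermite_add_two m i
  have h3 := coeff_hermite_mul_eq_coeff_hermite_add_two (m + 2) i
  push_cast at h2 h3 ⊢
  have h5 : ((m : ℤ) + 3) ≠ 0 := by positivity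
  apply mul_left_cancel₀ h5
  rw [h1]
  linear_combination ((m : ℤ) + 3) * (m + 3) * (m + 4) * h2 +
    (2 * (m + 1) * (m + 3) + (m + 3) * ((i : ℤ) - m - 2)) * h3

section

open scoped Nat

theorem Nat.dvd_doubleFactorial_of_odd {m : ℕ} (hm : Odd m) (j : ℕ) : m ∣ (m + 2 * j)‼ := by
  induction j with
  | zero =>
    obtain ⟨r, rfl⟩ := hm
    rw [mul_zero, add_zero, Nat.doubleFactorial_add_one]
    exact dvd_mul_right _ _
  | succ j ih =>
    rw [mul_add, ← add_assoc, Nat.doubleFactorial_add_two]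
    exact ih.mul_left _

theorem Nat.doubleFactorial_two_mul_sub_one_mul (m : ℕ) :
    (2 * m - 1)‼ * (2 ^ m * m !) = (2 * m)! := by
  rcases m with _ | m
  · simp
  · rw [← Nat.doubleFactorial_two_mul, show 2 * (m + 1) - 1 = 2 * m + 1 by omega,
      show 2 * (m + 1) = 2 * m + 1 + 1 by ring, Nat.factorial_eq_mul_doubleFactorial, mul_comm]

theorem Nat.doubleFactorial_two_mul_add_one_mul (m : ℕ) :
    (2 * m + 1)‼ * (2 ^ m * m !) = (2 * m + 1)! := by
  rw [← Nat.doubleFactorial_two_mul, Nat.factorial_eq_mul_doubleFactorial]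

theorem Nat.doubleFactorial_mul_choose_even (k t : ℕ) :
    (2 * (k + t) - 1)‼ * (k + t).choose k =
      (2 * k - 1)‼ * (2 * k + 2 * t).choose (2 * t) * (2 * t - 1)‼ := by
  have h1 := Nat.doubleFactorial_two_mul_sub_one_mul (k + t)
  have h2 := Nat.doubleFactorial_two_mul_sub_one_mul k
  have h3 := Nat.doubleFactorial_two_mul_sub_one_mul t
  have h4 := Nat.add_choose_mul_factorial_mul_factorial k t
  have h5 := Nat.add_choose_mul_factorial_mul_factorial (2 * k) (2 * t)
  rw [← Nat.choose_symm_add] at h4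
  have h0 : 0 < 2 ^ (k + t) * (k ! * t !) := by positivity
  apply Nat.eq_of_mul_eq_mul_right h0
  rw [mul_add 2 k t, ← h5, ← h2, ← h3, ← h4] at h1
  rw [mul_add 2 k t]
  linear_combination h1

theorem Nat.doubleFactorial_mul_choose_odd (k t : ℕ) :
    (2 * (k + t) + 1)‼ * (k + t).choose k =
      (2 * k - 1)‼ * (2 * k + (2 * t + 1)).choose (2 * t + 1) * (2 * t + 1)‼ := by
  have h1 := Nat.doubleFactorial_two_mul_add_one_mul (k + t)
  have h2 := Nat.doubleFactorial_two_mul_sub_one_mul k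
  have h3 := Nat.doubleFactorial_two_mul_add_one_mul t
  have h4 := Nat.add_choose_mul_factorial_mul_factorial k t
  have h5 := Nat.add_choose_mul_factorial_mul_factorial (2 * k) (2 * t + 1)
  rw [← Nat.choose_symm_add] at h4
  have h0 : 0 < 2 ^ (k + t) * (k ! * t !) := by positivity
  apply Nat.eq_of_mul_eq_mul_right h0
  rw [show 2 * (k + t) + 1 = 2 * k + (2 * t + 1) by ring, ← h5, ← h2, ← h3, ← h4] at h1
  rw [show 2 * (k + t) + 1 = 2 * k + (2 * t + 1) by ring]
  linear_combination h1

/-- The absolute value of the coefficients of the Hermite polynomials. -/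
theorem Polynomial.natAbs_coeff_hermite (k i : ℕ) :
    ((hermite (2 * k + i)).coeff i).natAbs = (2 * k - 1)‼ * (2 * k + i).choose i := by
  rw [coeff_hermite_explicit, Int.natAbs_mul, Int.natAbs_mul, Int.natAbs_pow]
  simp

theorem Nat.Prime.dvd_natAbs_coeff_hermite {p k i r : ℕ} (hp : p.Prime) (hodd : Odd p)
    (hr : r < 2 * k) (hd : p ∣ 2 * k + i - r) :
    p ∣ ((hermite (2 * k + i)).coeff i).natAbs := by
  rw [natAbs_coeff_hermite]
  rcases Nat.lt_or_ge (2 * k) p with h | h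
  · refine Dvd.dvd.mul_left ?_ _
    have h1 : p ∣ (2 * k + i).descFactorial (2 * k) := by
      rw [Nat.descFactorial_eq_prod_range]
      exact hd.trans (Finset.dvd_prod_of_mem (fun j => 2 * k + i - j) (Finset.mem_range.2 hr))
    rw [Nat.descFactorial_eq_factorial_mul_choose, hp.dvd_mul, hp.dvd_factorial,
      Nat.choose_symm_add] at h1
    exact h1.resolve_left (by omega)
  · refine Dvd.dvd.mul_right ?_ _
    obtain ⟨j, hj⟩ : ∃ j, 2 * k - 1 = p + 2 * j := by
      obtain ⟨q, rfl⟩ := hodd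
      exact ⟨k - 1 - q, by omega⟩
    rw [hj]
    exact Nat.dvd_doubleFactorial_of_odd hodd j

theorem intPadicAbs_natAbs (p : ℕ) [Fact p.Prime] (a : ℤ) :
    intPadicAbs p a.natAbs = intPadicAbs p a := by
  rcases Int.natAbs_eq a with h | h
  · rw [← h]
  · conv_rhs => rw [h, AbsoluteValue.map_neg]

theorem intPadicAbs_eq_one (p : ℕ) [Fact p.Prime] {a : ℤ} (h : ¬ (p : ℤ) ∣ a) :
    intPadicAbs p a = 1 := by
  rw [intPadicAbs_apply]
  exact_mod_cast padicNorm.int_eq_one_iff a |>.2 h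

theorem intPadicAbs_coeff_hermite_mul_doubleFactorial_le (p : ℕ) [Fact p.Prime] (k t : ℕ) {s : ℕ}
    (hs : s < 2) :
    intPadicAbs p ((hermite (2 * (k + t) + s)).coeff (2 * t + s)) *
      intPadicAbs p ((2 * t + 1)‼ : ℕ) ≤
    intPadicAbs p ((hermite (2 * (k + t) + s)).coeff s) := by
  have e : 2 * (k + t) + s = 2 * k + (2 * t + s) := by ring
  rw [← intPadicAbs_natAbs p (coeff _ s), natAbs_coeff_hermite, e, ← intPadicAbs_natAbs,
    natAbs_coeff_hermite, ← map_mul]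
  refine (?_ : _ ≤ intPadicAbs p
    ((((2 * (k + t) - 1)‼ * (2 * (k + t) + s).choose s * (k + t).choose k : ℕ) : ℤ))).trans ?_
  · apply intPadicAbs_le_of_dvd
    rw [← Nat.cast_mul, Int.natCast_dvd_natCast]
    interval_cases s
    · have h := Nat.doubleFactorial_mul_choose_even k t
      simp only [add_zero, Nat.choose_zero_right, mul_one]
      rw [h]
      refine mul_dvd_mul_left _ ?_
      rcases t with _ | t
      · simp
      · rw [show 2 * (t + 1) + 1 = 2 * (t + 1) - 1 + 2 by omega, Nat.doubleFactorial_add_two]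
        exact dvd_mul_left _ _
    · have h := Nat.doubleFactorial_mul_choose_odd k t
      rw [← h, Nat.choose_one_right, Nat.doubleFactorial_add_one]
      exact dvd_of_eq (congrArg (· * _) (mul_comm _ _))
  · apply intPadicAbs_le_of_dvd
    rw [Int.natCast_dvd_natCast, ← e]
    exact dvd_mul_right _ _

theorem intPadicAbs_three_coeff_hermite_le [Fact (Nat.Prime 3)] {k s : ℕ} (hs : s < 2)
    (h3 : 3 ∣ 2 * (k + 1) + s - 1) :
    intPadicAbs 3 ((hermite (2 * (k + 1) + s)).coeff (2 + s)) ≤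
      intPadicAbs 3 ((hermite (2 * (k + 1) + s)).coeff s) := by
  have e : 2 * (k + 1) + s = 2 * k + (2 + s) := by ring
  rw [← intPadicAbs_natAbs 3 (coeff _ s), natAbs_coeff_hermite, e, ← intPadicAbs_natAbs,
    natAbs_coeff_hermite, ← e]
  interval_cases s
  · have h := Nat.doubleFactorial_mul_choose_even k 1
    apply intPadicAbs_le_of_dvd
    rw [Int.natCast_dvd_natCast]
    exact ⟨(k + 1).choose k, by simpa [mul_add] using h.symm⟩
  · have h := Nat.doubleFactorial_mul_choose_odd k 1
    obtain ⟨q, hq⟩ : 3 ∣ k + 1 := by omega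
    apply intPadicAbs_le_of_dvd
    rw [Int.natCast_dvd_natCast]
    have h1 : (2 * (k + 1) + 1)‼ = (2 * (k + 1) + 1) * (2 * (k + 1) - 1)‼ :=
      Nat.doubleFactorial_add_one _
    rw [h1, Nat.choose_succ_self_right, hq, show (2 * 1 + 1)‼ = 3 from rfl] at h
    refine ⟨q, Nat.eq_of_mul_eq_mul_right (show 0 < 3 by norm_num) ?_⟩
    rw [Nat.choose_one_right, show 2 + 1 = 2 * 1 + 1 from rfl, hq,
      show 2 * (3 * q) + 1 = 2 * k + (2 * 1 + 1) by omega]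
    rw [show 2 * (3 * q) + 1 = 2 * k + (2 * 1 + 1) by omega] at h
    linear_combination h.symm

theorem sub_one_mul_padicValNat_doubleFactorial_le (p : ℕ) [Fact p.Prime] (t : ℕ) :
    (p - 1) * padicValNat p (2 * t + 1)‼ ≤ 2 * t := by
  have h1 := sub_one_mul_padicValNat_factorial_lt_of_ne_zero p (show 2 * t + 1 ≠ 0 by omega)
  have h2 : padicValNat p (2 * t + 1)‼ ≤ padicValNat p (2 * t + 1)! := by
    rw [Nat.factorial_eq_mul_doubleFactorial, padicValNat.mul (Nat.doubleFactorial_pos _).ne'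
      (Nat.doubleFactorial_pos _).ne']
    exact Nat.le_add_right _ _
  have h3 := Nat.mul_le_mul_left (p - 1) h2
  omega

theorem four_mul_padicValNat_three_doubleFactorial_le {t : ℕ} (ht : t ≠ 1) :
    4 * padicValNat 3 (2 * t + 1)‼ ≤ 3 * t := by
  have h1 := sub_one_mul_padicValNat_factorial_lt_of_ne_zero 3 (show 2 * t + 1 ≠ 0 by omega)
  have h2 : padicValNat 3 (2 * t + 1)! = padicValNat 3 (2 * t + 1)‼ + padicValNat 3 t ! := by
    rw [← Nat.doubleFactorial_two_mul_add_one_mul, padicValNat.mul (Nat.doubleFactorial_pos _).ne'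
      (by positivity), padicValNat.mul (by positivity) (by positivity), padicValNat.pow,
      padicValNat.eq_zero_of_not_dvd (show ¬ 3 ∣ 2 by norm_num), mul_zero, zero_add]
  have h3 : t / 3 ≤ padicValNat 3 t ! := by
    have h4 := padicValNat_factorial_mul (p := 3) (t / 3)
    have h5 := padicValNat_dvd_iff_le (p := 3) (a := t !) (n := t / 3) (by positivity)
    rw [← h5]
    refine dvd_trans ?_ (Nat.factorial_dvd_factorial (Nat.mul_div_le t 3))
    rw [padicValNat_dvd_iff_le (by positivity)]
    omega
  by_cases h2t : t = 2
  · subst h2t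
    have : ¬ 9 ∣ (2 * 2 + 1)‼ := by decide
    have h6 := padicValNat_dvd_iff_le (p := 3) (a := (2 * 2 + 1)‼) (n := 2) (by decide)
    omega
  by_cases h5t : t = 5
  · subst h5t
    have : ¬ 81 ∣ (2 * 5 + 1)‼ := by decide
    have h6 := padicValNat_dvd_iff_le (p := 3) (a := (2 * 5 + 1)‼) (n := 4) (by decide)
    omega
  omega

theorem le_mul_natDegree_of_dvd_remainder {n p ℓ r D a : ℕ} [Fact p.Prime] (hodd : Odd p)
    (hn : 2 ≤ n) (hpn : ¬ (p : ℤ) ∣ ((n : ℤ) + 2) * (n - 1)) (hℓ : Even ℓ) (hr : r ≤ ℓ + 1)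
    (hd : p ∣ n + 2 - r) (hD : 0 < D)
    (hval : ∀ t, D * padicValNat p (2 * t + 1)‼ ≤ a * (2 * t) ∨
      t = 1 ∧ p = 3 ∧ 3 ∣ n + 1)
    {HeL RL : ℤ[X]} (hHe : C (vand (degSeq ![n, 2])) * HeL = wronskHe (degSeq ![n, 2]))
    (hR : HeL = X ^ sStat (degSeq ![n, 2]) * RL) (hR0 : RL.coeff 0 ≠ 0)
    {g : ℤ[X]} (hg : g ∣ RL) (hdeg : ℓ < g.natDegree) : D ≤ a * g.natDegree := by
  set s := n % 2 with hs
  have hs2 : s < 2 := Nat.mod_lt _ (by norm_num)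
  have hp : p.Prime := Fact.out
  have hcoeff : ∀ j, ((n : ℤ) + 2) * (n - 1) * RL.coeff j =
      (((j + s : ℕ) - 2 : ℤ) ^ 2 + (n - 2)) * (hermite (n + 2)).coeff (j + s) := by
    intro j
    rw [← coeff_wronskianHermite_two hn hHe, hR, degSeq_two, sStat_two_succ, coeff_X_pow_mul]
  have hne : ((n : ℤ) + 2) * (n - 1) ≠ 0 := by
    intro h0; rw [h0] at hpn; exact hpn (dvd_zero _)
  have hzero : ∀ j, Odd (n + j + s) ∨ n + 2 < j + s → RL.coeff j = 0 := by
    intro j hj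
    have h := hcoeff j
    have h0 : (hermite (n + 2)).coeff (j + s) = 0 := by
      rcases hj with hj | hj
      · exact coeff_hermite_of_odd_add (by rw [Nat.odd_iff] at *; omega)
      · exact coeff_hermite_of_lt hj
    rw [h0, mul_zero] at h
    exact (mul_eq_zero.1 h).resolve_left hne
  have htop : RL.coeff (n + 2 - s) = 1 := by
    have h := hcoeff (n + 2 - s)
    rw [Nat.sub_add_cancel (by omega), coeff_hermite_self] at h
    push_cast at h
    exact mul_left_cancel₀ hne (by linear_combination h)
  have hdegR : RL.natDegree = n + 2 - s :=
    natDegree_eq_of_le_of_coeff_ne_zero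
      (natDegree_le_iff_coeff_eq_zero.2 fun j hj => hzero j (Or.inr (by omega)))
      (by rw [htop]; exact one_ne_zero)
  have hv : ∀ j, intPadicAbs p (RL.coeff j) ≤
      intPadicAbs p ((hermite (n + 2)).coeff (j + s)) := by
    intro j
    have h := congrArg (intPadicAbs p) (hcoeff j)
    rw [map_mul, map_mul _ _ (coeff _ _), intPadicAbs_eq_one p hpn, one_mul] at h
    rw [h]
    exact mul_le_of_le_one_left (AbsoluteValue.nonneg _ _) (intPadicAbs_le_one _ _)
  have hv0 : intPadicAbs p (RL.coeff 0) = intPadicAbs p ((hermite (n + 2)).coeff s) := by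
    have h := congrArg (intPadicAbs p) (hcoeff 0)
    rw [map_mul, map_mul _ _ (coeff _ _), intPadicAbs_eq_one p hpn, one_mul, zero_add] at h
    rw [h, intPadicAbs_eq_one, one_mul]
    refine fun hdvd => hpn ?_
    interval_cases s
    · exact Dvd.dvd.mul_right (hdvd.trans (dvd_of_eq (by push_cast; ring))) _
    · exact Dvd.dvd.mul_left (hdvd.trans (dvd_of_eq (by push_cast; ring))) _
  have hp0 : (0 : ℝ) < (p : ℝ)⁻¹ := inv_pos.2 (by exact_mod_cast hp.pos)
  have hp1 : (p : ℝ)⁻¹ < 1 := inv_lt_one_of_one_lt₀ (by exact_mod_cast hp.one_lt)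
  obtain ⟨d, hd0, hdD⟩ : ∃ d : ℝ, 0 < d ∧ d ^ D = (p : ℝ)⁻¹ :=
    ⟨(p : ℝ)⁻¹ ^ ((D : ℝ)⁻¹), Real.rpow_pos_of_pos hp0 _, Real.rpow_inv_natCast_pow hp0.le hD.ne'⟩
  have hd1 : d < 1 := by
    by_contra! h
    have := one_le_pow₀ h (n := D)
    linarith
  have key := pow_natDegree_le_inv_prime_of_dvd p (R := RL) (g := g) (ℓ := ℓ) (c := d ^ a)
    (pow_pos hd0 _) (by rw [leadingCoeff, hdegR, htop]; exact isUnit_one) hR0 ?_ ?_ hg hdeg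
  · rw [← hdD, ← pow_mul] at key
    exact (pow_le_pow_iff_right_of_lt_one₀ hd0 hd1).1 key
  · intro j hj
    rw [hdegR] at hj
    rcases Nat.even_or_odd (n + j + s) with he | ho
    · have hj' : (p : ℤ) ∣ (hermite (n + 2)).coeff (j + s) := by
        obtain ⟨k, hk⟩ : ∃ k, n + 2 = 2 * k + (j + s) := by
          rw [Nat.even_iff] at he
          exact ⟨(n + 2 - (j + s)) / 2, by omega⟩
        have hkr : r < 2 * k := by
          obtain ⟨q, rfl⟩ := hℓ
          omega
        rw [hk] at hd ⊢
        exact Int.natCast_dvd.2 (hp.dvd_natAbs_coeff_hermite hodd hkr hd)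
      exact ((Nat.prime_iff_prime_int.1 hp).dvd_or_dvd
        ((hcoeff j).symm ▸ hj'.mul_left _)).resolve_left hpn
    · rw [hzero j (Or.inl ho)]
      exact dvd_zero _
  · intro j
    rcases em (Odd (n + j + s) ∨ n + 2 < j + s) with h | h
    · rw [hzero j h, map_zero, zero_mul]
      exact AbsoluteValue.nonneg _ _
    · obtain ⟨hm, hlt⟩ := not_or.1 h
      obtain ⟨m, hm⟩ := Nat.not_odd_iff_even.1 hm
      obtain ⟨t, rfl⟩ : ∃ t, j = 2 * t := ⟨j / 2, by omega⟩
      obtain ⟨k, hk⟩ : ∃ k, n + 2 = 2 * (k + t) + s := ⟨m + 1 - 2 * t - s, by omega⟩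
      have hvj := hv (2 * t)
      have hc1 : (d ^ a) ^ (2 * t) ≤ 1 := pow_le_one₀ (by positivity) (pow_le_one₀ hd0.le hd1.le)
      rw [hv0]
      rcases hval t with h | ⟨rfl, rfl, h3⟩
      · have hmain := intPadicAbs_coeff_hermite_mul_doubleFactorial_le p k t hs2
        rw [← hk] at hmain
        refine le_trans (mul_le_mul hvj ?_ (by positivity) (AbsoluteValue.nonneg _ _)) hmain
        rw [intPadicAbs_natCast p (Nat.doubleFactorial_pos _).ne', ← hdD, ← pow_mul, ← pow_mul]
        exact pow_le_pow_of_le_one hd0.le hd1.le h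
      · have hmain := intPadicAbs_three_coeff_hermite_le (k := k) hs2
          (by rw [← hk]; exact h3)
        rw [← hk] at hmain
        exact (mul_le_of_le_one_right (AbsoluteValue.nonneg _ _) hc1).trans (hvj.trans hmain)

theorem not_dvd_add_two_mul_sub_one {n p r : ℕ} (hrn : r ≤ n + 2) (hd : p ∣ n + 2 - r)
    (h : ¬ (p : ℤ) ∣ r * (r - 3)) : ¬ (p : ℤ) ∣ ((n : ℤ) + 2) * (n - 1) := by
  obtain ⟨q, hq⟩ := hd
  have hq' : (n : ℤ) + 2 = p * q + r := by
    have : n + 2 = p * q + r := by omega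
    exact_mod_cast this
  refine fun hdvd => h ((Int.dvd_add_right (Dvd.intro (q * (p * q + 2 * r - 3)) rfl)).1
    (?_ : (p : ℤ) ∣ p * (q * (p * q + 2 * r - 3)) + r * (r - 3)))
  convert hdvd using 1
  rw [show (n : ℤ) = p * q + r - 2 by linarith]
  ring

theorem pred_le_natDegree_of_dvd_remainder {n p ℓ r : ℕ} (hp : p.Prime) (hodd : Odd p)
    (hn : 2 ≤ n) (hrn : r ≤ n + 2) (hpr : ¬ (p : ℤ) ∣ r * (r - 3)) (hℓ : Even ℓ) (hr : r ≤ ℓ + 1)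
    (hd : p ∣ n + 2 - r)
    {HeL RL : ℤ[X]} (hHe : C (vand (degSeq ![n, 2])) * HeL = wronskHe (degSeq ![n, 2]))
    (hR : HeL = X ^ sStat (degSeq ![n, 2]) * RL) (hR0 : RL.coeff 0 ≠ 0)
    {g : ℤ[X]} (hg : g ∣ RL) (hdeg : ℓ < g.natDegree) : p - 1 ≤ g.natDegree := by
  have : Fact p.Prime := ⟨hp⟩
  have h := le_mul_natDegree_of_dvd_remainder (D := p - 1) (a := 1) hodd hn
    (not_dvd_add_two_mul_sub_one hrn hd hpr) hℓ hr hd (Nat.sub_pos_of_lt hp.one_lt)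
    (fun t => Or.inl (by rw [one_mul]; exact sub_one_mul_padicValNat_doubleFactorial_le p t))
    hHe hR hR0 hg hdeg
  rwa [one_mul] at h

theorem three_le_natDegree_of_dvd_remainder {n : ℕ} (hn : 2 ≤ n) (hd : 3 ∣ n + 1)
    {HeL RL : ℤ[X]} (hHe : C (vand (degSeq ![n, 2])) * HeL = wronskHe (degSeq ![n, 2]))
    (hR : HeL = X ^ sStat (degSeq ![n, 2]) * RL) (hR0 : RL.coeff 0 ≠ 0)
    {g : ℤ[X]} (hg : g ∣ RL) (hdeg : 0 < g.natDegree) : 3 ≤ g.natDegree := by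
  have : Fact (Nat.Prime 3) := ⟨Nat.prime_three⟩
  have h := le_mul_natDegree_of_dvd_remainder (p := 3) (r := 1) (D := 8) (a := 3) (by decide) hn
    (not_dvd_add_two_mul_sub_one (r := 1) (by omega) hd (by norm_num)) Even.zero le_rfl hd
    (by norm_num) (fun t => ?_) hHe hR hR0 hg hdeg
  · omega
  · rcases eq_or_ne t 1 with rfl | ht
    · exact Or.inr ⟨rfl, rfl, hd⟩
    · have := four_mul_padicValNat_three_doubleFactorial_le ht
      left
      omega

end

/-- Lemma `lem:factor9forn2`.  Let `n ≥ 1000`.  Then `R_{n,2}` has no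
factor in `ℤ[X]` of degree `d` for any `3 ≤ d ≤ 9`; moreover, if `n + 1` is not a power
of `2`, then `R_{n,2}` has no factor of degree `1` or `2` either. -/
theorem stmt18 (n : ℕ) (hn : 1000 ≤ n)
    (HeL RL : Polynomial ℤ)
    (hHe : Polynomial.C (vand (degSeq ![n, 2])) * HeL = wronskHe (degSeq ![n, 2]))
    (hR : HeL = Polynomial.X ^ sStat (degSeq ![n, 2]) * RL)
    (hR0 : RL.coeff 0 ≠ 0) :
    (∀ d : ℕ, 3 ≤ d → d ≤ 9 →
      ¬ ∃ g : Polynomial ℤ, g.natDegree = d ∧ g ∣ RL) ∧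
    ((¬ ∃ l : ℕ, n + 1 = 2 ^ l) →
      ∀ d : ℕ, 1 ≤ d → d ≤ 2 →
        ¬ ∃ g : Polynomial ℤ, g.natDegree = d ∧ g ∣ RL) := by
  have small : ∀ {p m : ℕ}, m < p → 0 < m → ∀ {z : ℤ}, z.natAbs = m → ¬ (p : ℤ) ∣ z := by
    intro p m hmp hm z hz hdvd
    have := Nat.le_of_dvd (by omega) (Int.natCast_dvd.1 hdvd)
    omega
  refine ⟨?_, ?_⟩
  · rintro d hd3 hd9 ⟨g, rfl, hg⟩
    rcases Nat.lt_or_ge 4 g.natDegree with h4 | h4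
    · obtain ⟨p, hp, hp11, hd⟩ := Nat.exists_prime_eleven_le_dvd hn
      have hodd : Odd p := hp.odd_of_ne_two (by omega)
      have h : p - 1 ≤ g.natDegree := by
        rcases hd with hd | hd | hd | hd
        · exact pred_le_natDegree_of_dvd_remainder (ℓ := 0) (r := 1) hp hodd (by omega) (by omega)
            (small (m := 2) (by omega) (by norm_num) (by norm_num)) (by decide) (by norm_num) hd
            hHe hR hR0 hg (by omega)
        · exact pred_le_natDegree_of_dvd_remainder (ℓ := 2) (r := 2) hp hodd (by omega) (by omega)
            (small (m := 2) (by omega) (by norm_num) (by norm_num)) (by decide) (by norm_num) hd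
            hHe hR hR0 hg (by omega)
        · exact pred_le_natDegree_of_dvd_remainder (ℓ := 4) (r := 4) hp hodd (by omega) (by omega)
            (small (m := 4) (by omega) (by norm_num) (by norm_num)) (by decide) (by norm_num) hd
            hHe hR hR0 hg (by omega)
        · exact pred_le_natDegree_of_dvd_remainder (ℓ := 4) (r := 5) hp hodd (by omega) (by omega)
            (small (m := 10) (by omega) (by norm_num) (by norm_num)) (by decide) (by norm_num) hd
            hHe hR hR0 hg (by omega)
      omega
    · obtain ⟨p, hp, hp7, hd⟩ := Nat.exists_prime_seven_le_dvd_mul_succ (n := n) (by omega)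
      have hodd : Odd p := hp.odd_of_ne_two (by omega)
      have h : p - 1 ≤ g.natDegree := by
        rcases hd with hd | hd
        · exact pred_le_natDegree_of_dvd_remainder (ℓ := 2) (r := 2) hp hodd (by omega) (by omega)
            (small (m := 2) (by omega) (by norm_num) (by norm_num)) (by decide) (by norm_num) hd
            hHe hR hR0 hg (by omega)
        · exact pred_le_natDegree_of_dvd_remainder (ℓ := 0) (r := 1) hp hodd (by omega) (by omega)
            (small (m := 2) (by omega) (by norm_num) (by norm_num)) (by decide) (by norm_num) hd
            hHe hR hR0 hg (by omega)
      omega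
  · rintro hpow d hd1 hd2 ⟨g, rfl, hg⟩
    obtain ⟨p, hp, hd, hp2⟩ : ∃ p, p.Prime ∧ p ∣ n + 1 ∧ p ≠ 2 := by
      by_contra! hall
      exact hpow ⟨_, Nat.eq_prime_pow_of_unique_prime_dvd (by omega) fun hq hqd => hall _ hq hqd⟩
    have hodd : Odd p := hp.odd_of_ne_two hp2
    have := hp.two_le
    rcases eq_or_ne p 3 with rfl | hp3
    · have := three_le_natDegree_of_dvd_remainder (by omega) hd hHe hR hR0 hg hd1
      omega
    · have h := pred_le_natDegree_of_dvd_remainder (ℓ := 0) (r := 1) hp hodd (by omega) (by omega)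
        (small (m := 2) (by omega) (by norm_num) (by norm_num)) (by decide) (by norm_num) hd
        hHe hR hR0 hg (by omega)
      obtain ⟨q, rfl⟩ := hodd
      omega
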